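/- For every finite field F_q and every γ ∈ (0,1) there exists α > 0 such that the following holds: if X and Y are independent random variables in F_q with H̄(X) ≤ α and H̄(Y) ≤ α, then H̄(X + Y) ≥ (1 − γ)·(H̄(X) + H̄(Y)). -/

import Mathlib

open MeasureTheory ProbabilityTheory Real Finset

/-- The probability mass that the random variable `X` puts on the value `a`. -/
noncomputable def massOf {Ω : Type*} [MeasurableSpace Ω] (μ : Measure Ω)
    {S : Type*} (X : Ω → S) (a : S) : ℝ :=
  (μ (X ⁻¹' {a})).toReal

/-- Shannon entropy (in bits) of a random variable with values in a finite type. -/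
noncomputable def entropy {Ω : Type*} [MeasurableSpace Ω] (μ : Measure Ω)
    {S : Type*} [Fintype S] (X : Ω → S) : ℝ :=
  (∑ a : S, Real.negMulLog (massOf μ X a)) / Real.log 2

/-- Conditional Shannon entropy (in bits) `H(X | Y)`. -/
noncomputable def condEntropy {Ω : Type*} [MeasurableSpace Ω] (μ : Measure Ω)
    {S T : Type*} [Fintype S] [Fintype T] (X : Ω → S) (Y : Ω → T) : ℝ :=
  ∑ b : T, massOf μ Y b * entropy (μ[|Y ⁻¹' {b}]) X

/-- Normalized (`q`-ary) entropy `H̄(X) = H(X) / log₂ q`. -/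
noncomputable def nEntropy {Ω : Type*} [MeasurableSpace Ω] (μ : Measure Ω)
    {S : Type*} [Fintype S] (X : Ω → S) : ℝ :=
  entropy μ X / Real.logb 2 (Fintype.card S)

/-- Normalized conditional entropy `H̄(X|Y) = H(X|Y) / log₂ q`. -/
noncomputable def nCondEntropy {Ω : Type*} [MeasurableSpace Ω] (μ : Measure Ω)
    {S T : Type*} [Fintype S] [Fintype T] (X : Ω → S) (Y : Ω → T) : ℝ :=
  condEntropy μ X Y / Real.logb 2 (Fintype.card S)

namespace Real

/-- `negMulLog` is increasing on `[0, e⁻¹]`. -/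
lemma negMulLog_le_negMulLog_of_le_exp_neg_one {u v : ℝ} (hu : 0 ≤ u) (huv : u ≤ v)
    (hv : v ≤ exp (-1)) : negMulLog u ≤ negMulLog v := by
  rcases hu.eq_or_lt with rfl | hu
  · rw [negMulLog_zero]
    exact negMulLog_nonneg huv (hv.trans (exp_le_one_iff.2 (by norm_num)))
  have hv0 : 0 < v := hu.trans_le huv
  have hlog : log v ≤ -1 := (log_le_iff_le_exp hv0).2 hv
  have hdiv : u * (log v - log u) ≤ v - u := by
    rw [← log_div hv0.ne' hu.ne']
    calc u * log (v / u) ≤ u * (v / u - 1) := by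
          gcongr
          exact log_le_sub_one_of_pos (by positivity)
      _ = v - u := by field_simp
  unfold negMulLog
  nlinarith [mul_nonneg (sub_nonneg.2 huv) (by linarith : 0 ≤ -1 - log v)]

lemma mul_le_negMulLog_of_le_exp_neg {x K : ℝ} (hx : 0 ≤ x) (hxK : x ≤ exp (-K)) :
    K * x ≤ negMulLog x := by
  rcases hx.eq_or_lt with rfl | hx
  · simp
  have := (log_le_iff_le_exp hx).2 hxK
  unfold negMulLog
  nlinarith

lemma negMulLog_le_one_sub {x : ℝ} (hx : 0 ≤ x) : negMulLog x ≤ 1 - x := by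
  rcases hx.eq_or_lt with rfl | hx
  · simp
  have h := mul_le_mul_of_nonneg_left (one_sub_inv_le_log_of_pos hx) hx.le
  have : x * (1 - x⁻¹) = x - 1 := by field_simp
  unfold negMulLog
  linarith

lemma mul_one_sub_le_negMulLog {x : ℝ} (hx : 0 ≤ x) : x * (1 - x) ≤ negMulLog x := by
  rcases hx.eq_or_lt with rfl | hx
  · simp
  have := log_le_sub_one_of_pos hx
  unfold negMulLog
  nlinarith

lemma negMulLog_add_sub_le {x y : ℝ} (hx : 0 ≤ x) (hy : 0 ≤ y) :
    negMulLog x + negMulLog y - (x + y) ≤ negMulLog (x + y) := by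
  have key : ∀ {a b : ℝ}, 0 ≤ a → 0 ≤ b → a * (log (a + b) - log a) ≤ b := by
    intro a b ha hb
    rcases ha.eq_or_lt with rfl | ha
    · simpa using hb
    rw [← log_div (by positivity) ha.ne']
    calc a * log ((a + b) / a) ≤ a * ((a + b) / a - 1) := by
          gcongr
          exact log_le_sub_one_of_pos (by positivity)
      _ = b := by field_simp; ring
  have h1 := key hx hy
  have h2 := key hy hx
  rw [add_comm y x] at h2
  unfold negMulLog
  linarith

lemma mul_negMulLog_le {t z : ℝ} (ht : 0 ≤ t) (ht1 : t ≤ 1) (hz : 0 ≤ z) :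
    t * negMulLog z ≤ negMulLog (t * z) := by
  rw [negMulLog_mul]
  linarith [mul_nonneg hz (negMulLog_nonneg ht ht1)]

lemma sq_mul_negMulLog_add_le {K x y v : ℝ} (hK : 3 ≤ K) (hx : 0 ≤ x) (hy : 0 ≤ y)
    (hxK : x ≤ exp (-K)) (hyK : y ≤ exp (-K)) (hv : (1 - exp (-K)) * (x + y) ≤ v)
    (hv1 : v ≤ exp (-1)) :
    (1 - 1 / K) ^ 2 * (negMulLog x + negMulLog y) ≤ negMulLog v := by
  have hK0 : 0 < K := by linarith
  have hexp : exp (-K) ≤ 1 / K := by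
    rw [exp_neg, ← one_div]
    exact one_div_le_one_div_of_le hK0 (by linarith [add_one_le_exp K])
  have hKinv : 0 < 1 / K := by positivity
  have hK1 : 1 / K ≤ 1 := by rw [div_le_one hK0]; linarith
  have hz : 0 ≤ x + y := add_nonneg hx hy
  have hmono : negMulLog ((1 - 1 / K) * (x + y)) ≤ negMulLog v :=
    negMulLog_le_negMulLog_of_le_exp_neg_one (mul_nonneg (by linarith) hz)
      ((mul_le_mul_of_nonneg_right (by linarith) hz).trans hv) hv1
  have hscale := mul_negMulLog_le (t := 1 - 1 / K) (by linarith) (by linarith) hz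
  have hadd := negMulLog_add_sub_le hx hy
  have hsmall : x + y ≤ 1 / K * (negMulLog x + negMulLog y) := by
    rw [one_div, inv_mul_eq_div, le_div_iff₀ hK0]
    linarith [mul_le_negMulLog_of_le_exp_neg hx hxK, mul_le_negMulLog_of_le_exp_neg hy hyK]
  calc (1 - 1 / K) ^ 2 * (negMulLog x + negMulLog y)
      = (1 - 1 / K) * ((1 - 1 / K) * (negMulLog x + negMulLog y)) := by ring
    _ ≤ (1 - 1 / K) * negMulLog (x + y) := by
        apply mul_le_mul_of_nonneg_left _ (by linarith)
        linarith
    _ ≤ negMulLog v := hscale.trans hmono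

end Real

/-- A probability vector with small entropy has an entry close to `1`. -/
lemma exists_one_sub_sum_negMulLog_le {S : Type*} [Fintype S] [Nonempty S] {p : S → ℝ}
    (hp : ∀ a, 0 ≤ p a) (hsum : ∑ a, p a = 1) :
    ∃ a, 1 - ∑ b, negMulLog (p b) ≤ p a := by
  obtain ⟨a, ha⟩ := Finite.exists_max p
  refine ⟨a, ?_⟩
  have h1 : ∑ b, p b * (1 - p b) ≤ ∑ b, negMulLog (p b) :=
    sum_le_sum fun b _ => mul_one_sub_le_negMulLog (hp b)
  have h2 : ∑ b, p b * (1 - p a) ≤ ∑ b, p b * (1 - p b) :=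
    sum_le_sum fun b _ => mul_le_mul_of_nonneg_left (by linarith [ha b]) (hp b)
  rw [← sum_mul, hsum] at h2
  linarith

/-- If almost all the mass sits at one point, the entropy is carried by the other points. -/
lemma mul_sum_negMulLog_le_sum_erase {S : Type*} [Fintype S] [DecidableEq S] {p : S → ℝ}
    {K : ℝ} (hK : 1 ≤ K) (hp : ∀ a, 0 ≤ p a) (hsum : ∑ a, p a = 1) (o : S)
    (ho : 1 - exp (-K) ≤ p o) :
    (1 - 1 / K) * ∑ a, negMulLog (p a) ≤ ∑ a ∈ univ.erase o, negMulLog (p a) := by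
  have hK0 : 0 < K := by linarith
  have hK1 : 1 / K ≤ 1 := by rwa [div_le_one hK0]
  have hmass := add_sum_erase univ p (mem_univ o)
  rw [hsum] at hmass
  have hle : ∀ a ∈ univ.erase o, p a ≤ exp (-K) := fun a ha => by
    linarith [single_le_sum (f := p) (fun i _ => hp i) ha]
  have hT : K * (1 - p o) ≤ ∑ a ∈ univ.erase o, negMulLog (p a) := by
    rw [← hmass, add_sub_cancel_left, mul_sum]
    exact sum_le_sum fun a ha => mul_le_negMulLog_of_le_exp_neg (hp a) (hle a ha)
  rw [← add_sum_erase univ (fun a => negMulLog (p a)) (mem_univ o)]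
  set T := ∑ a ∈ univ.erase o, negMulLog (p a)
  have ho' : negMulLog (p o) ≤ 1 / K * T := by
    refine (negMulLog_le_one_sub (hp o)).trans ?_
    rw [one_div, inv_mul_eq_div, le_div_iff₀ hK0]
    linarith
  have hpo : p o ≤ 1 := by
    linarith [sum_nonneg fun a (_ : a ∈ univ.erase o) => hp a]
  have hT0 : 0 ≤ T := (mul_nonneg hK0.le (by linarith)).trans hT
  calc (1 - 1 / K) * (negMulLog (p o) + T)
      ≤ (1 - 1 / K) * (1 / K * T + T) :=
        mul_le_mul_of_nonneg_left (by linarith) (by linarith)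
    _ = T - (1 / K) ^ 2 * T := by ring
    _ ≤ T := by linarith [mul_nonneg (sq_nonneg (1 / K)) hT0]

/-- The convolution of two probability vectors with mass at least `1 - e⁻ᴷ` at `0`
loses at most a fraction `3 / K` of the total entropy. -/
lemma cube_mul_sum_negMulLog_add_le_of_zero {G : Type*} [AddCommGroup G] [Fintype G]
    {p r s : G → ℝ} {K : ℝ} (hK : 3 ≤ K)
    (hp : ∀ a, 0 ≤ p a) (hr : ∀ a, 0 ≤ r a) (hpsum : ∑ a, p a = 1) (hrsum : ∑ a, r a = 1)
    (hs : ∀ c, s c = ∑ a, p a * r (c - a)) (hssum : ∑ c, s c = 1)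
    (hp0 : 1 - exp (-K) ≤ p 0) (hr0 : 1 - exp (-K) ≤ r 0) :
    (1 - 1 / K) ^ 3 * (∑ a, negMulLog (p a) + ∑ a, negMulLog (r a))
      ≤ ∑ c, negMulLog (s c) := by
  classical
  have hK0 : 0 < K := by linarith
  have hK1 : 1 / K ≤ 1 := by rw [div_le_one hK0]; linarith
  have hs_nonneg : ∀ c, 0 ≤ s c := fun c => by
    rw [hs]
    exact sum_nonneg fun a _ => mul_nonneg (hp a) (hr _)
  have hs_le : ∀ c, s c ≤ 1 := fun c => by
    rw [← hssum]
    exact single_le_sum (fun i _ => hs_nonneg i) (mem_univ c)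
  have hpair : ∀ {f : G → ℝ}, (∀ a, 0 ≤ f a) → ∑ a, f a = 1 → ∀ c ≠ 0, f 0 + f c ≤ 1 := by
    intro f hf hfs c hc
    rw [← hfs, ← sum_pair hc.symm]
    exact sum_le_sum_of_subset_of_nonneg (subset_univ _) fun i _ _ => hf i
  have hs0 : p 0 * r 0 ≤ s 0 := by
    rw [hs]
    simpa using single_le_sum (f := fun a => p a * r (0 - a))
      (fun a _ => mul_nonneg (hp a) (hr _)) (mem_univ 0)
  have hp01 : p 0 ≤ 1 := hpsum ▸ single_le_sum (fun i _ => hp i) (mem_univ 0)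
  have hr01 : r 0 ≤ 1 := hrsum ▸ single_le_sum (fun i _ => hr i) (mem_univ 0)
  have hexp : 2 * exp (-K) ≤ exp (-1) := by
    have h3 : exp (-K) ≤ exp (-3) := exp_le_exp.2 (by linarith)
    have h2 : exp (-1) = exp 2 * exp (-3) := by rw [← exp_add]; norm_num
    nlinarith [add_one_le_exp (2 : ℝ), exp_pos (-3)]
  have hpoint : ∀ c ∈ univ.erase (0 : G),
      (1 - 1 / K) ^ 2 * (negMulLog (p c) + negMulLog (r c)) ≤ negMulLog (s c) := by
    intro c hc
    have hc0 : c ≠ 0 := ne_of_mem_erase hc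
    refine sq_mul_negMulLog_add_le hK (hp c) (hr c) ?_ ?_ ?_ ?_
    · linarith [hpair hp hpsum c hc0]
    · linarith [hpair hr hrsum c hc0]
    · have h : p 0 * r c + p c * r 0 ≤ s c := by
        rw [hs]
        have := sum_le_sum_of_subset_of_nonneg (f := fun a => p a * r (c - a))
          (subset_univ {0, c}) fun a _ _ => mul_nonneg (hp a) (hr _)
        rw [sum_pair hc0.symm] at this
        simpa using this
      nlinarith [mul_le_mul_of_nonneg_right hp0 (hr c), mul_le_mul_of_nonneg_right hr0 (hp c)]
    · have := hpair hs_nonneg hssum c hc0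
      nlinarith [mul_nonneg (sub_nonneg.2 hp01) (sub_nonneg.2 hr01)]
  have hTp := mul_sum_negMulLog_le_sum_erase (by linarith) hp hpsum 0 hp0
  have hTr := mul_sum_negMulLog_le_sum_erase (by linarith) hr hrsum 0 hr0
  calc (1 - 1 / K) ^ 3 * (∑ a, negMulLog (p a) + ∑ a, negMulLog (r a))
      = (1 - 1 / K) ^ 2 * ((1 - 1 / K) * ∑ a, negMulLog (p a)
          + (1 - 1 / K) * ∑ a, negMulLog (r a)) := by ring
    _ ≤ (1 - 1 / K) ^ 2 * (∑ a ∈ univ.erase 0, negMulLog (p a)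
          + ∑ a ∈ univ.erase 0, negMulLog (r a)) := by gcongr
    _ = ∑ c ∈ univ.erase 0, (1 - 1 / K) ^ 2 * (negMulLog (p c) + negMulLog (r c)) := by
        rw [← sum_add_distrib, mul_sum]
    _ ≤ ∑ c ∈ univ.erase 0, negMulLog (s c) := sum_le_sum hpoint
    _ ≤ ∑ c, negMulLog (s c) :=
        sum_le_sum_of_subset_of_nonneg (erase_subset _ _)
          fun c _ _ => negMulLog_nonneg (hs_nonneg c) (hs_le c)

lemma cube_mul_sum_negMulLog_add_le {G : Type*} [AddCommGroup G] [Fintype G]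
    {p r s : G → ℝ} {K : ℝ} (hK : 3 ≤ K)
    (hp : ∀ a, 0 ≤ p a) (hr : ∀ a, 0 ≤ r a) (hpsum : ∑ a, p a = 1) (hrsum : ∑ a, r a = 1)
    (hs : ∀ c, s c = ∑ a, p a * r (c - a)) (hssum : ∑ c, s c = 1)
    (hHp : ∑ a, negMulLog (p a) ≤ exp (-K)) (hHr : ∑ a, negMulLog (r a) ≤ exp (-K)) :
    (1 - 1 / K) ^ 3 * (∑ a, negMulLog (p a) + ∑ a, negMulLog (r a))
      ≤ ∑ c, negMulLog (s c) := by
  obtain ⟨x, hx⟩ := exists_one_sub_sum_negMulLog_le hp hpsum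
  obtain ⟨y, hy⟩ := exists_one_sub_sum_negMulLog_le hr hrsum
  have shift : ∀ (f : G → ℝ) (z : G), ∑ a, f (z + a) = ∑ a, f a :=
    fun f z => Equiv.sum_comp (Equiv.addLeft z) f
  have key := cube_mul_sum_negMulLog_add_le_of_zero (p := fun a => p (x + a))
    (r := fun a => r (y + a)) (s := fun c => s (x + y + c)) hK (fun _ => hp _) (fun _ => hr _)
    ((shift p x).trans hpsum) ((shift r y).trans hrsum) ?_ ((shift s _).trans hssum)
    (by simpa using (by linarith : 1 - exp (-K) ≤ p x))
    (by simpa using (by linarith : 1 - exp (-K) ≤ r y))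
  · rwa [shift (fun a => negMulLog (p a)), shift (fun a => negMulLog (r a)),
      shift (fun a => negMulLog (s a))] at key
  · intro c
    rw [hs, ← shift _ x]
    refine sum_congr rfl fun a _ => ?_
    congr 2
    abel

lemma massOf_nonneg {Ω : Type*} [MeasurableSpace Ω] {μ : Measure Ω} {S : Type*} (X : Ω → S) (a : S) :
    0 ≤ massOf μ X a :=
  ENNReal.toReal_nonneg

section Mass

variable {Ω : Type*} [MeasurableSpace Ω] {μ : Measure Ω} [IsProbabilityMeasure μ]

lemma sum_massOf {S : Type*} [Fintype S] [MeasurableSpace S] [MeasurableSingletonClass S]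
    {X : Ω → S} (hX : Measurable X) : ∑ a, massOf μ X a = 1 := by
  have h := sum_measureReal_preimage_singleton (μ := μ) (univ : Finset S) (f := X)
    fun a _ => hX (measurableSet_singleton a)
  simpa [massOf, measureReal_def] using h

lemma massOf_add {G : Type*} [AddCommGroup G] [Fintype G] [MeasurableSpace G]
    [MeasurableSingletonClass G] {X Y : Ω → G} (hX : Measurable X) (hY : Measurable Y)
    (hXY : IndepFun X Y μ) (c : G) :
    massOf μ (fun ω => X ω + Y ω) c = ∑ a, massOf μ X a * massOf μ Y (c - a) := by
  have hset : (fun ω => X ω + Y ω) ⁻¹' {c} =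
      ⋃ a ∈ (univ : Finset G), X ⁻¹' {a} ∩ Y ⁻¹' {c - a} := by
    ext ω
    simp [eq_sub_iff_add_eq']
  have hdisj : (↑(univ : Finset G) : Set G).PairwiseDisjoint
      fun a => X ⁻¹' {a} ∩ Y ⁻¹' {c - a} := by
    intro a _ b _ hab
    refine Set.disjoint_left.2 fun ω h1 h2 => hab ?_
    exact h1.1.symm.trans h2.1
  rw [massOf, hset, measure_biUnion_finset hdisj fun a _ =>
    (hX (measurableSet_singleton a)).inter (hY (measurableSet_singleton _)),
    ENNReal.toReal_sum fun a _ => measure_ne_top _ _]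
  refine sum_congr rfl fun a _ => ?_
  rw [hXY.measure_inter_preimage_eq_mul _ _ (measurableSet_singleton a)
    (measurableSet_singleton _), ENNReal.toReal_mul]
  rfl

end Mass

lemma nEntropy_eq_sum_div_log {Ω : Type*} [MeasurableSpace Ω] (μ : Measure Ω)
    {S : Type*} [Fintype S] (X : Ω → S) :
    nEntropy μ X = (∑ a, negMulLog (massOf μ X a)) / log (Fintype.card S) := by
  have h2 : log 2 ≠ 0 := (log_pos one_lt_two).ne'
  rw [nEntropy, entropy, logb, div_div_div_cancel_right₀ h2]


/-- **Lemma (suction at the lower end, unconditional version).** For every finite field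
`F_q` and `γ ∈ (0,1)` there is `α > 0` such that for independent `X, Y ∈ F_q` with
`H̄(X), H̄(Y) ≤ α`, one has `H̄(X + Y) ≥ (1 − γ)(H̄(X) + H̄(Y))`. -/
theorem suction_at_lower_end_unconditional
    (F : Type*) [Field F] [Fintype F] [MeasurableSpace F] [MeasurableSingletonClass F]
    (γ : ℝ) (hγ0 : 0 < γ) (hγ1 : γ < 1) :
    ∃ α : ℝ, 0 < α ∧
      ∀ (Ω : Type) [MeasurableSpace Ω] (μ : Measure Ω) [IsProbabilityMeasure μ]
        (X Y : Ω → F), Measurable X → Measurable Y → IndepFun X Y μ →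
        nEntropy μ X ≤ α → nEntropy μ Y ≤ α →
        (1 - γ) * (nEntropy μ X + nEntropy μ Y) ≤ nEntropy μ (fun ω => X ω + Y ω) := by
  have hq : 0 < log (Fintype.card F) := log_pos (by exact_mod_cast Fintype.one_lt_card)
  refine ⟨exp (-(3 / γ)) / log (Fintype.card F), by positivity, ?_⟩
  intro Ω _ μ _ X Y hX hY hXY hHX hHY
  have hK : 3 ≤ 3 / γ := by
    rw [le_div_iff₀ hγ0]
    linarith
  have hXYm : ∑ c, massOf μ (fun ω => X ω + Y ω) c = 1 := by
    exact sum_massOf ((measurable_of_countable fun z : F × F => z.1 + z.2).comp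
      (hX.prodMk hY))
  rw [nEntropy_eq_sum_div_log, div_le_div_iff_of_pos_right hq] at hHX hHY
  have key := cube_mul_sum_negMulLog_add_le hK (massOf_nonneg X) (massOf_nonneg Y)
    (sum_massOf hX) (sum_massOf hY) (massOf_add hX hY hXY) hXYm hHX hHY
  rw [nEntropy_eq_sum_div_log, nEntropy_eq_sum_div_log, nEntropy_eq_sum_div_log, ← add_div,
    ← mul_div_assoc, div_le_div_iff_of_pos_right hq]
  refine le_trans (mul_le_mul_of_nonneg_right ?_ ?_) key
  · have : (1 : ℝ) / (3 / γ) = γ / 3 := by field_simp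
    rw [this]
    nlinarith [mul_pos hγ0 hγ0, mul_pos (mul_pos hγ0 hγ0) (sub_pos.2 hγ1)]
  · have hnn : ∀ {Z : Ω → F}, Measurable Z → 0 ≤ ∑ a, negMulLog (massOf μ Z a) :=
      fun {Z} hZ => sum_nonneg fun a _ => negMulLog_nonneg (massOf_nonneg Z a)
        (sum_massOf (μ := μ) hZ ▸
          single_le_sum (fun i _ => massOf_nonneg Z i) (mem_univ a))
    exact add_nonneg (hnn hX) (hnn hY)
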